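/- Let λ ∈ (−π/2, π/2), let f ∈ F_λ and let g ∈ S* be the starlike function corresponding to f via L_f = e^{iλ}(cos λ)·L_g (equivalently f(z)/z = (g(z)/z)^{e^{iλ} cos λ}). Then A(f) = A(g). -/

import Mathlib

open Set Metric Filter Topology

/-- The class `F_λ` of (normalized) `λ`-spirallike functions on the unit disk. -/
def SpiralClass (lam : ℝ) : Set (ℂ → ℂ) :=
  {f | DifferentiableOn ℂ f (ball (0 : ℂ) 1) ∧ f 0 = 0 ∧ deriv f 0 = 1 ∧
    (∀ z ∈ ball (0 : ℂ) 1, z ≠ 0 → f z ≠ 0) ∧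
    ∀ z ∈ ball (0 : ℂ) 1, z ≠ 0 →
      0 < (Complex.exp (-(lam : ℂ) * Complex.I) * z * deriv f z / f z).re}

/-- `L` is the (unique) analytic branch of `log (f z / z)` on the disk vanishing at `0`. -/
def IsLogBranch (f L : ℂ → ℂ) : Prop :=
  DifferentiableOn ℂ L (ball (0 : ℂ) 1) ∧ L 0 = 0 ∧
    ∀ z ∈ ball (0 : ℂ) 1, z ≠ 0 → Complex.exp (L z) = f z / z

/-- `α(R, f)`: the length (in `[0, 2π]`) of the largest open arc `I` of the unit circle
such that `R·ζ ∈ f(𝔻)` for every `ζ ∈ I` (and `0` if there is no such arc). -/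
noncomputable def arcLength (f : ℂ → ℂ) (R : ℝ) : ℝ :=
  sSup {a : ℝ | 0 ≤ a ∧ a ≤ 2 * Real.pi ∧ ∃ θ₀ : ℝ, ∀ ψ : ℝ, |ψ - θ₀| < a / 2 →
    (R : ℂ) * Complex.exp ((ψ : ℂ) * Complex.I) ∈ f '' ball (0 : ℂ) 1}

/-- the logarithmic lift. -/
noncomputable def lift (L : ℂ → ℂ) (ζ : ℂ) : ℂ := ζ + L (Complex.exp ζ)

/-- its derivative. -/
noncomputable def liftD (L : ℂ → ℂ) (ζ : ℂ) : ℂ :=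
  1 + Complex.exp ζ * deriv L (Complex.exp ζ)

lemma exp_mem_ball {ζ : ℂ} (h : ζ.re < 0) : Complex.exp ζ ∈ ball (0 : ℂ) 1 := by
  simp [Complex.norm_exp, h]

lemma hasDerivAt_lift {L : ℂ → ℂ} (hL : DifferentiableOn ℂ L (ball (0 : ℂ) 1)) {ζ : ℂ}
    (h : ζ.re < 0) : HasDerivAt (lift L) (liftD L ζ) ζ := by
  have h1 : HasDerivAt L (deriv L (Complex.exp ζ)) (Complex.exp ζ) :=
    (hL.differentiableAt (isOpen_ball.mem_nhds (exp_mem_ball h))).hasDerivAt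
  have h2 := (hasDerivAt_id ζ).add (h1.comp ζ (Complex.hasDerivAt_exp ζ))
  rw [liftD, mul_comm]
  exact h2

lemma isOpen_H : IsOpen {ζ : ℂ | ζ.re < 0} := isOpen_lt Complex.continuous_re continuous_const

lemma hasStrictDerivAt_lift {L : ℂ → ℂ} (hL : DifferentiableOn ℂ L (ball (0 : ℂ) 1)) {ζ : ℂ}
    (h : ζ.re < 0) : HasStrictDerivAt (lift L) (liftD L ζ) ζ := by
  have hd : DifferentiableOn ℂ (lift L) {ζ : ℂ | ζ.re < 0} := fun x hx =>
    (hasDerivAt_lift hL hx).differentiableAt.differentiableWithinAt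
  have ha : AnalyticAt ℂ (lift L) ζ := hd.analyticAt (isOpen_H.mem_nhds h)
  have := ha.hasStrictDerivAt
  rwa [(hasDerivAt_lift hL h).deriv] at this

lemma lift_shift (L : ℂ → ℂ) (ζ : ℂ) (k : ℤ) :
    lift L (ζ + k * (2 * Real.pi * Complex.I)) = lift L ζ + k * (2 * Real.pi * Complex.I) := by
  have : Complex.exp (ζ + k * (2 * Real.pi * Complex.I)) = Complex.exp ζ := by
    rw [Complex.exp_add, Complex.exp_int_mul_two_pi_mul_I, mul_one]
  simp only [lift, this]; ring

lemma lift_injOn {L : ℂ → ℂ} {τ : ℝ} (hL : DifferentiableOn ℂ L (ball (0 : ℂ) 1))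
    (hD : ∀ ζ : ℂ, ζ.re < 0 → 0 < (liftD L ζ).re + τ * (liftD L ζ).im) :
    InjOn (lift L) {ζ : ℂ | ζ.re < 0} := by
  intro a ha b hb hab
  by_contra hne
  replace ha : a.re < 0 := ha
  replace hb : b.re < 0 := hb
  have hba : b - a ≠ 0 := sub_ne_zero.mpr (Ne.symm hne)
  let c : ℂ := (1 - τ * Complex.I) / (b - a)
  have hseg : ∀ t ∈ Icc (0 : ℝ) 1, (a + t * (b - a)).re < 0 := by
    intro t ht
    simp only [Complex.add_re, Complex.mul_re, Complex.ofReal_re, Complex.ofReal_im,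
      Complex.sub_re, zero_mul, sub_zero]
    rcases ht with ⟨h0, h1⟩
    rcases eq_or_lt_of_le h0 with h | h
    · subst h; simpa using ha
    · nlinarith
  have hder : ∀ t ∈ Icc (0 : ℝ) 1, HasDerivAt (fun t : ℝ => (c * lift L (a + t * (b - a))).re)
      ((1 - τ * Complex.I) * liftD L (a + t * (b - a))).re t := by
    intro t ht
    have h1 := hasDerivAt_lift hL (hseg t ht)
    have h2 : HasDerivAt (fun x : ℂ => a + x * (b - a)) (b - a) (t : ℂ) := by
      simpa using ((hasDerivAt_id (t : ℂ)).mul_const (b - a)).const_add a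
    have h3 := ((h1.comp (t : ℂ) h2).const_mul c).real_of_complex
    have h4 : c * (liftD L (a + t * (b - a)) * (b - a))
        = (1 - τ * Complex.I) * liftD L (a + t * (b - a)) := by
      simp only [c]; field_simp
    rw [h4] at h3
    exact h3
  have hcont : ContinuousOn (fun t : ℝ => (c * lift L (a + t * (b - a))).re) (Icc 0 1) :=
    fun t ht => (hder t ht).continuousAt.continuousWithinAt
  obtain ⟨t, ht, he⟩ := exists_hasDerivAt_eq_slope _ _ (zero_lt_one) hcont
    (fun t ht => hder t (Ioo_subset_Icc_self ht))
  have h5 := hD _ (hseg t (Ioo_subset_Icc_self ht))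
  have h6 : ((1 - τ * Complex.I) * liftD L (a + t * (b - a))).re = 0 := by
    rw [he]; simp [hab]
  simp only [Complex.mul_re, Complex.sub_re, Complex.one_re, Complex.sub_im, Complex.one_im,
    Complex.mul_im, Complex.I_re, Complex.I_im, Complex.ofReal_re, Complex.ofReal_im] at h6
  linarith

lemma L_bound {L : ℂ → ℂ} (hL : DifferentiableOn ℂ L (ball (0 : ℂ) 1)) {x₀ : ℝ} (hx : x₀ < 0) :
    ∃ M, ∀ ζ : ℂ, ζ.re ≤ x₀ → ‖L (Complex.exp ζ)‖ ≤ M := by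
  have hsub : closedBall (0 : ℂ) (Real.exp x₀) ⊆ ball 0 1 := closedBall_subset_ball (by simpa)
  obtain ⟨M, hM⟩ := (isCompact_closedBall (0 : ℂ) (Real.exp x₀)).exists_bound_of_continuousOn
    (hL.continuousOn.mono hsub)
  refine ⟨M, fun ζ h => hM _ ?_⟩
  simp [Complex.norm_exp, h]

lemma isClosed_lift_image {L : ℂ → ℂ} (hL : DifferentiableOn ℂ L (ball (0 : ℂ) 1)) {x₀ : ℝ}
    (hx : x₀ < 0) : IsClosed (lift L '' {ζ : ℂ | ζ.re ≤ x₀}) := by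
  obtain ⟨M, hM⟩ := L_bound hL hx
  have hK : IsClosed {ζ : ℂ | ζ.re ≤ x₀} := isClosed_le Complex.continuous_re continuous_const
  apply IsSeqClosed.isClosed
  intro w w₀ hw hlim
  choose ζ hζ he using hw
  obtain ⟨B, hB⟩ := (isBounded_range_of_tendsto _ hlim).exists_norm_le
  have hbd : ∀ n, ζ n ∈ closedBall (0 : ℂ) (B + M) := by
    intro n
    have h1 : ‖w n‖ ≤ B := hB _ (mem_range_self n)
    have h2 := hM _ (hζ n)
    have h3 : ζ n = w n - L (Complex.exp (ζ n)) := by rw [← he n, lift]; ring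
    rw [mem_closedBall_zero_iff, h3]
    exact (norm_sub_le _ _).trans (add_le_add h1 h2)
  obtain ⟨z, -, φ, hφ, hz⟩ := (isCompact_closedBall (0 : ℂ) (B + M)).tendsto_subseq hbd
  have hzK : z ∈ {ζ : ℂ | ζ.re ≤ x₀} := hK.mem_of_tendsto hz (Eventually.of_forall fun n => hζ _)
  refine ⟨z, hzK, ?_⟩
  have hc := (hasDerivAt_lift hL (lt_of_le_of_lt hzK hx)).continuousAt.tendsto.comp hz
  refine tendsto_nhds_unique hc ?_
  have : (lift L ∘ (ζ ∘ φ)) = w ∘ φ := by ext n; simp [he]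
  rw [this]
  exact hlim.comp hφ.tendsto_atTop

lemma lift_leftinv {L : ℂ → ℂ} {τ : ℝ} (hL : DifferentiableOn ℂ L (ball (0 : ℂ) 1))
    (hD : ∀ ζ : ℂ, ζ.re < 0 → 0 < (liftD L ζ).re + τ * (liftD L ζ).im)
    {ζ₀ : ℂ} (h₀ : ζ₀.re < 0) {T : ℝ} (hT : 0 ≤ T) :
    lift L ζ₀ - T * (1 + τ * Complex.I) ∈ lift L '' {ζ : ℂ | ζ.re < 0} := by
  set d : ℂ := 1 + τ * Complex.I with hd
  set S : Set ℝ := {t | lift L ζ₀ - t * d ∈ lift L '' {ζ : ℂ | ζ.re ≤ ζ₀.re}} with hS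
  have hclosed : IsClosed S :=
    (isClosed_lift_image hL h₀).preimage (by fun_prop)
  have hsub : Icc 0 T ⊆ S := by
    apply IsClosed.Icc_subset_of_forall_exists_gt (hclosed.inter isClosed_Icc)
    · exact ⟨ζ₀, le_refl ζ₀.re, by simp⟩
    · rintro x ⟨⟨ζ, hζ, he⟩, hx⟩ y hy
      have hζ' : ζ.re ≤ ζ₀.re := hζ
      have hζn : ζ.re < 0 := lt_of_le_of_lt hζ h₀
      have hpos := hD ζ hζn
      have hne : liftD L ζ ≠ 0 := by
        intro h; rw [h] at hpos; simp at hpos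
      have hs := hasStrictDerivAt_lift hL hζn
      have hinv := (hs.to_localInverse hne).hasDerivAt
      have hright : ∀ᶠ w in 𝓝 (lift L ζ), lift L (hs.localInverse _ _ _ hne w) = w :=
        (hs.hasStrictFDerivAt_equiv hne).eventually_right_inverse
      have hleft : hs.localInverse _ _ _ hne (lift L ζ) = ζ :=
        (hs.hasStrictFDerivAt_equiv hne).localInverse_apply_image
      set inv := hs.localInverse _ _ _ hne with hinvdef
      have hpath : HasDerivAt (fun s : ℂ => lift L ζ₀ - s * d) (-d) (x : ℂ) := by
        simpa using ((hasDerivAt_id (x : ℂ)).mul_const d).const_sub (lift L ζ₀)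
      rw [he] at hinv hleft hright
      have hcomp : HasDerivAt (fun t : ℝ => (inv (lift L ζ₀ - t * d)).re)
          ((liftD L ζ)⁻¹ * -d).re x := (hinv.comp (x : ℂ) hpath).real_of_complex
      have hneg : ((liftD L ζ)⁻¹ * -d).re < 0 := by
        have hn : 0 < Complex.normSq (liftD L ζ) := Complex.normSq_pos.mpr hne
        have : ((liftD L ζ)⁻¹ * -d).re
            = -(((liftD L ζ).re + τ * (liftD L ζ).im) / Complex.normSq (liftD L ζ)) := by
          simp [hd, Complex.inv_re, Complex.inv_im]; ring
        rw [this]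
        exact neg_lt_zero.mpr (div_pos hpos hn)
      have hev1 : ∀ᶠ t : ℝ in 𝓝[>] x, (inv (lift L ζ₀ - t * d)).re < ζ.re := by
        have := (hasDerivAt_iff_tendsto_slope.mp hcomp)
        have h2 := (this.mono_left (nhdsWithin_mono x (fun (t : ℝ) (ht : x < t) => ne_of_gt ht))).eventually
          (gt_mem_nhds hneg)
        filter_upwards [h2, self_mem_nhdsWithin] with t ht hxt
        have hxt' : 0 < t - x := sub_pos.mpr hxt
        rw [slope_def_field, div_lt_iff₀ hxt', hleft] at ht
        linarith
      have hev2 : ∀ᶠ t : ℝ in 𝓝[>] x, lift L (inv (lift L ζ₀ - t * d)) = lift L ζ₀ - t * d := by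
        have hc : Tendsto (fun t : ℝ => lift L ζ₀ - t * d) (𝓝 x) (𝓝 (lift L ζ₀ - x * d)) :=
          Continuous.tendsto (by fun_prop) x
        exact (hc.eventually hright).filter_mono nhdsWithin_le_nhds
      have hev3 : ∀ᶠ t in 𝓝[>] x, t ∈ Ioc x y := Ioc_mem_nhdsGT hy
      obtain ⟨t, h1, h2, h3⟩ := (hev1.and (hev2.and hev3)).exists
      exact ⟨t, ⟨_, (h1.le.trans hζ' : (inv (lift L ζ₀ - t * d)).re ≤ ζ₀.re), h2⟩, h3⟩
  obtain ⟨ζ, hζ, he⟩ := hsub ⟨hT, le_rfl⟩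
  exact ⟨ζ, lt_of_le_of_lt hζ h₀, he⟩

lemma im_bound {L : ℂ → ℂ} (hL : DifferentiableOn ℂ L (ball (0 : ℂ) 1)) (hL0 : L 0 = 0)
    (hD : ∀ ζ : ℂ, ζ.re < 0 → 0 < (liftD L ζ).re) {ζ : ℂ} (hζ : ζ.re < 0) :
    |(L (Complex.exp ζ)).im| ≤ 2 * Real.pi := by
  set x := ζ.re with hx
  set u : ℝ → ℝ := fun s => (L (Complex.exp (x + s * Complex.I))).im with hu
  have hre : ∀ s : ℝ, ((x : ℂ) + s * Complex.I).re < 0 := by intro s; simpa using hζ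
  have hder : ∀ s : ℝ, HasDerivAt (fun s : ℝ => s + u s) (liftD L (x + s * Complex.I)).re s := by
    intro s
    have h1 := hasDerivAt_lift hL (hre s)
    have h2 : HasDerivAt (fun y : ℂ => (x : ℂ) + y * Complex.I) Complex.I (s : ℂ) := by
      simpa using ((hasDerivAt_id (s : ℂ)).mul_const Complex.I).const_add (x : ℂ)
    have h3 := ((h1.comp (s : ℂ) h2).const_mul (-Complex.I)).real_of_complex
    convert h3 using 1
    · ext s; simp [lift, hu]
    · congr 1
      linear_combination (liftD L (x + s * Complex.I)) * Complex.I_mul_I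
  have hmono : StrictMono (fun s : ℝ => s + u s) :=
    strictMono_of_hasDerivAt_pos hder (fun s => hD _ (hre s))
  have hucont : Continuous u := by
    have h1 : Continuous (fun s : ℝ => s + u s) :=
      continuous_iff_continuousAt.mpr fun s => (hder s).continuousAt
    have : u = fun s => (s + u s) - s := by ext; ring
    rw [this]; exact h1.sub continuous_id
  have hper : Function.Periodic u (2 * Real.pi) := by
    intro s
    simp only [hu]
    congr 2
    rw [← Complex.exp_periodic ((x : ℂ) + s * Complex.I)]
    congr 1; push_cast; ring
  obtain ⟨s₁, hs₁⟩ : ∃ s₁, u s₁ = 0 := by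
    have hsub : closedBall (0 : ℂ) |Real.exp x| ⊆ ball 0 1 :=
      closedBall_subset_ball (by rw [abs_of_pos (Real.exp_pos x)]; simpa)
    have hav : Real.circleAverage L 0 (Real.exp x) = L 0 := by
      apply DiffContOnCl.circleAverage
      refine DifferentiableOn.diffContOnCl (hL.mono ?_)
      exact closure_ball_subset_closedBall.trans hsub
    have hmap : ∀ θ : ℝ, circleMap 0 (Real.exp x) θ = Complex.exp (x + θ * Complex.I) := by
      intro θ
      rw [circleMap_zero, Complex.exp_add, Complex.ofReal_exp]
    rw [hL0, Real.circleAverage_def, smul_eq_zero] at hav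
    have hint : (∫ θ in (0 : ℝ)..2 * Real.pi, L (circleMap 0 (Real.exp x) θ)) = 0 :=
      hav.resolve_left (inv_ne_zero Real.two_pi_pos.ne')
    simp only [hmap] at hint
    have hLc : Continuous fun θ : ℝ => L (Complex.exp (x + θ * Complex.I)) :=
      hL.continuousOn.comp_continuous (by fun_prop) (fun θ => exp_mem_ball (hre θ))
    have hui : (∫ θ in (0 : ℝ)..2 * Real.pi, u θ) = 0 := by
      have := Complex.imCLM.intervalIntegral_comp_comm
        (hLc.intervalIntegrable (μ := MeasureTheory.volume) 0 (2 * Real.pi))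
      rw [hint] at this
      simpa [hu] using this
    obtain ⟨s₁, -, hs₁⟩ := exists_eq_interval_average Real.two_pi_pos.ne hucont.continuousOn
    refine ⟨s₁, ?_⟩
    rw [hs₁, interval_average_eq, hui, smul_zero]
  obtain ⟨s, hs, he⟩ := hper.exists_mem_Ico Real.two_pi_pos ζ.im s₁
  have h0 : u ζ.im = (L (Complex.exp ζ)).im := by
    simp only [hu, hx, Complex.re_add_im]
  rw [← h0, he, abs_le]
  have h1 := hmono.monotone hs.1
  have h2 := hmono.monotone hs.2.le
  have h3 := hper s₁
  constructor <;> linarith [hs.1, hs.2]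

lemma transfer {F₁ F₂ : ℂ → ℂ} {τ₁ τ₂ C : ℝ}
    (hinj : InjOn F₁ {ζ : ℂ | ζ.re < 0})
    (hstr : ∀ ζ : ℂ, ζ.re < 0 → ∃ D ≠ 0, HasStrictDerivAt F₁ D ζ)
    (hF₂ : ContinuousOn F₂ {ζ : ℂ | ζ.re < 0})
    (hinv : ∀ ζ : ℂ, ζ.re < 0 → ∀ T : ℝ, 0 ≤ T →
      F₂ ζ - T * (1 + τ₂ * Complex.I) ∈ F₂ '' {ζ : ℂ | ζ.re < 0})
    (hC : ∀ ζ : ℂ, ζ.re < 0 →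
      |((F₂ ζ).im - τ₂ * (F₂ ζ).re) - ((F₁ ζ).im - τ₁ * (F₁ ζ).re)| ≤ C * |ζ.re|)
    (hT : ∀ ε > 0, ∀ M : ℝ, ∃ T : ℝ, ∀ ζ : ℂ, ζ.re < 0 → T ≤ (F₁ ζ).re →
      -ε < ζ.re ∧ M ≤ (F₂ ζ).re)
    {σ b : ℝ}
    (h₁ : ∀ w : ℂ, |w.im - τ₁ * w.re - σ| < b → w ∈ F₁ '' {ζ : ℂ | ζ.re < 0}) :
    ∀ w : ℂ, |w.im - τ₂ * w.re - σ| < b → w ∈ F₂ '' {ζ : ℂ | ζ.re < 0} := by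
  intro w hw
  set s := w.im - τ₂ * w.re with hs
  obtain ⟨δ, hδ, hδb⟩ : ∃ δ > 0, |s - σ| + δ < b := ⟨(b - |s - σ|) / 2, by linarith, by linarith⟩
  have hC1 : (0 : ℝ) < |C| + 1 := by positivity
  obtain ⟨T, hT⟩ := hT (δ / (|C| + 1)) (div_pos hδ hC1) w.re
  let p : ℝ → ℂ := fun φ => T + (φ + τ₁ * T : ℝ) * Complex.I
  have hpre : ∀ φ, (p φ).re = T := by intro φ; simp [p]
  have hpim : ∀ φ, (p φ).im = φ + τ₁ * T := by intro φ; simp [p]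
  have hp : ∀ φ ∈ Icc (s - δ) (s + δ), p φ ∈ F₁ '' {ζ : ℂ | ζ.re < 0} := by
    intro φ hφ
    apply h₁
    rw [hpre, hpim]
    have : φ + τ₁ * T - τ₁ * T - σ = (s - σ) + (φ - s) := by ring
    rw [this]
    refine (abs_add_le _ _).trans_lt (lt_of_le_of_lt ?_ hδb)
    have : |φ - s| ≤ δ := abs_le.mpr ⟨by linarith [hφ.1], by linarith [hφ.2]⟩
    linarith
  let G := Function.invFunOn F₁ {ζ : ℂ | ζ.re < 0}
  have hGm : ∀ φ ∈ Icc (s - δ) (s + δ), (G (p φ)).re < 0 := fun φ hφ =>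
    Function.invFunOn_mem (hp φ hφ)
  have hGe : ∀ φ ∈ Icc (s - δ) (s + δ), F₁ (G (p φ)) = p φ := fun φ hφ =>
    Function.invFunOn_eq (hp φ hφ)
  have hGcont : ∀ w ∈ F₁ '' {ζ : ℂ | ζ.re < 0}, ContinuousAt G w := by
    rintro w ⟨ζ, hζ, rfl⟩
    obtain ⟨D, hD, hs⟩ := hstr ζ hζ
    have hright : ∀ᶠ w in 𝓝 (F₁ ζ), F₁ (hs.localInverse _ _ _ hD w) = w :=
        (hs.hasStrictFDerivAt_equiv hD).eventually_right_inverse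
    have hleft : hs.localInverse _ _ _ hD (F₁ ζ) = ζ :=
        (hs.hasStrictFDerivAt_equiv hD).localInverse_apply_image
    have hc : ContinuousAt (hs.localInverse _ _ _ hD) (F₁ ζ) :=
      (hs.to_localInverse hD).hasDerivAt.continuousAt
    have hmem : ∀ᶠ w in 𝓝 (F₁ ζ), (hs.localInverse _ _ _ hD w) ∈ {ζ : ℂ | ζ.re < 0} := by
      apply hc.eventually
      rw [hleft]
      exact isOpen_H.mem_nhds hζ
    refine hc.congr ?_
    filter_upwards [hright, hmem] with w h1 h2
    have h3 : w ∈ F₁ '' {ζ : ℂ | ζ.re < 0} := ⟨_, h2, h1⟩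
    exact hinj h2 (Function.invFunOn_mem h3) (h1.trans (Function.invFunOn_eq h3).symm)
  have hpc : Continuous p := by fun_prop
  let h : ℝ → ℝ := fun φ => (F₂ (G (p φ))).im - τ₂ * (F₂ (G (p φ))).re
  have hFG : ContinuousOn (fun φ => F₂ (G (p φ))) (Icc (s - δ) (s + δ)) := by
    intro φ hφ
    have c1 : ContinuousAt F₂ (G (p φ)) := hF₂.continuousAt (isOpen_H.mem_nhds (hGm φ hφ))
    have c2 : ContinuousAt (fun φ => G (p φ)) φ :=
      ContinuousAt.comp (f := p) (g := G) (hGcont _ (hp φ hφ)) hpc.continuousAt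
    exact (ContinuousAt.comp (f := fun φ => G (p φ)) (g := F₂) c1 c2).continuousWithinAt
  have hcont : ContinuousOn h (Icc (s - δ) (s + δ)) :=
    (Complex.continuous_im.comp_continuousOn hFG).sub
      (continuousOn_const.mul (Complex.continuous_re.comp_continuousOn hFG))
  have hclose : ∀ φ ∈ Icc (s - δ) (s + δ), |h φ - φ| ≤ δ := by
    intro φ hφ
    have h2 := hC _ (hGm φ hφ)
    rw [hGe φ hφ, hpre, hpim] at h2
    have h3 := (hT _ (hGm φ hφ) (by rw [hGe φ hφ, hpre])).1
    have h4 : |(G (p φ)).re| ≤ δ / (|C| + 1) :=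
      abs_le.mpr ⟨h3.le, (hGm φ hφ).le.trans (div_pos hδ hC1).le⟩
    have h5 : C * |(G (p φ)).re| ≤ δ := by
      calc C * |(G (p φ)).re| ≤ (|C| + 1) * (δ / (|C| + 1)) := by
            gcongr
            linarith [le_abs_self C]
        _ = δ := by field_simp
    have h6 : φ + τ₁ * T - τ₁ * T = φ := by ring
    rw [h6] at h2
    exact h2.trans h5
  have hle : s - δ ≤ s + δ := by linarith
  have ha := abs_le.mp (hclose _ (left_mem_Icc.mpr hle))
  have hb := abs_le.mp (hclose _ (right_mem_Icc.mpr hle))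
  obtain ⟨φ, hφ, he⟩ := intermediate_value_Icc hle hcont
    (show s ∈ Icc (h (s - δ)) (h (s + δ)) from ⟨by linarith, by linarith⟩)
  have hM := (hT _ (hGm φ hφ) (by rw [hGe φ hφ, hpre])).2
  have hfin := hinv _ (hGm φ hφ) ((F₂ (G (p φ))).re - w.re) (by linarith)
  convert hfin using 1
  have he' : (F₂ (G (p φ))).im - τ₂ * (F₂ (G (p φ))).re = w.im - τ₂ * w.re := he
  apply Complex.ext
  · simp
  · simp; linarith

lemma mem_image_iff {f L : ℂ → ℂ} (hL : IsLogBranch f L) (h0 : f 0 = 0) {R : ℝ} (hR : 0 < R)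
    (ψ : ℝ) : (R : ℂ) * Complex.exp ((ψ : ℂ) * Complex.I) ∈ f '' ball (0 : ℂ) 1 ↔
      (Real.log R : ℂ) + ψ * Complex.I ∈ lift L '' {ζ : ℂ | ζ.re < 0} := by
  have hRe : (R : ℂ) * Complex.exp ((ψ : ℂ) * Complex.I)
      = Complex.exp ((Real.log R : ℂ) + ψ * Complex.I) := by
    rw [Complex.exp_add, ← Complex.ofReal_exp, Real.exp_log hR]
  have hfe : ∀ ζ : ℂ, ζ.re < 0 → f (Complex.exp ζ) = Complex.exp (lift L ζ) := by
    intro ζ hζ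
    have := hL.2.2 _ (exp_mem_ball hζ) (Complex.exp_ne_zero ζ)
    rw [lift, Complex.exp_add, this]
    field_simp [Complex.exp_ne_zero ζ]
  rw [hRe]
  constructor
  · rintro ⟨z, hz, he⟩
    have hz0 : z ≠ 0 := by
      rintro rfl
      rw [h0] at he
      exact Complex.exp_ne_zero _ he.symm
    have hre : (Complex.log z).re < 0 := by
      rw [Complex.log_re]
      exact Real.log_neg (norm_pos_iff.mpr hz0) (by simpa using hz)
    have h1 := hfe _ hre
    rw [Complex.exp_log hz0, he, Complex.exp_eq_exp_iff_exists_int] at h1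
    obtain ⟨n, hn⟩ := h1
    refine ⟨Complex.log z + n * (2 * Real.pi * Complex.I), ?_, ?_⟩
    · simpa using hre
    · rw [lift_shift, hn]
  · rintro ⟨ζ, hζ, he⟩
    exact ⟨_, exp_mem_ball hζ, by rw [hfe ζ hζ, he]⟩

lemma strip_le {f L : ℂ → ℂ} {τ : ℝ} (hL : IsLogBranch f L) (h0 : f 0 = 0) {A : ℝ}
    (hA : Tendsto (arcLength f) atTop (𝓝 A)) {a : ℝ} (ha0 : 0 ≤ a) (ha : a ≤ 2 * Real.pi) {σ : ℝ}
    (h : ∀ w : ℂ, |w.im - τ * w.re - σ| < a / 2 → w ∈ lift L '' {ζ : ℂ | ζ.re < 0}) : a ≤ A := by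
  refine ge_of_tendsto hA ?_
  filter_upwards [eventually_gt_atTop 0] with R hR
  refine le_csSup ⟨2 * Real.pi, fun x hx => hx.2.1⟩ ⟨ha0, ha, σ + τ * Real.log R, ?_⟩
  intro ψ hψ
  rw [mem_image_iff hL h0 hR]
  apply h
  simp only [Complex.add_im, Complex.add_re, Complex.mul_im, Complex.mul_re, Complex.ofReal_re,
    Complex.ofReal_im, Complex.I_re, Complex.I_im]
  convert hψ using 2
  ring

lemma exists_strip {f L : ℂ → ℂ} {τ : ℝ} (hL : IsLogBranch f L) (h0 : f 0 = 0)
    (hD : ∀ ζ : ℂ, ζ.re < 0 → 0 < (liftD L ζ).re + τ * (liftD L ζ).im) {A : ℝ}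
    (hA : Tendsto (arcLength f) atTop (𝓝 A)) {a : ℝ} (ha0 : 0 ≤ a) (ha : a < A) :
    a ≤ 2 * Real.pi ∧ ∃ σ : ℝ, ∀ w : ℂ, |w.im - τ * w.re - σ| < a / 2 →
      w ∈ lift L '' {ζ : ℂ | ζ.re < 0} := by
  have hev : ∀ᶠ R : ℝ in atTop, ∃ b : ℝ, a < b ∧ 0 < R ∧ b ≤ 2 * Real.pi ∧ ∃ θ₀ : ℝ, ∀ ψ : ℝ,
      |ψ - θ₀| < b / 2 →
      (R : ℂ) * Complex.exp ((ψ : ℂ) * Complex.I) ∈ f '' ball (0 : ℂ) 1 := by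
    filter_upwards [hA.eventually (lt_mem_nhds ha), eventually_gt_atTop 0] with R hR hR0
    unfold arcLength at hR
    obtain ⟨b, hb, hab⟩ := exists_lt_of_lt_csSup
      (by exact ⟨0, le_rfl, Real.two_pi_pos.le, 0, fun ψ hψ => absurd hψ (by simp)⟩) hR
    exact ⟨b, hab, hR0, hb.2⟩
  have hev2 : ∀ᶠ n : ℕ in atTop, a ≤ 2 * Real.pi ∧ ∃ σ ∈ Icc (0 : ℝ) (2 * Real.pi), ∀ w : ℂ,
      w.re ≤ n → |w.im - τ * w.re - σ| < a / 2 → w ∈ lift L '' {ζ : ℂ | ζ.re < 0} := by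
    have hexp : Tendsto (fun n : ℕ => Real.exp n) atTop atTop :=
      Real.tendsto_exp_atTop.comp tendsto_natCast_atTop_atTop
    filter_upwards [hexp.eventually hev] with n ⟨b, hab, hR, hb, θ, hθ⟩
    refine ⟨hab.le.trans hb, toIcoMod Real.two_pi_pos 0 (θ - τ * n), ?_, ?_⟩
    · have := toIcoMod_mem_Ico Real.two_pi_pos 0 (θ - τ * n)
      exact ⟨this.1, by simpa using this.2.le⟩
    · intro w hw hwa
      set k := toIcoDiv Real.two_pi_pos 0 (θ - τ * n) with hk
      have hmod : toIcoMod Real.two_pi_pos 0 (θ - τ * n) = θ - τ * n - k * (2 * Real.pi) := by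
        rw [toIcoMod, zsmul_eq_mul]
      rw [hmod] at hwa
      have h1 := hθ (w.im + τ * (n - w.re) + k * (2 * Real.pi)) (by
        refine lt_trans ?_ (div_lt_div_of_pos_right hab two_pos)
        have hr : w.im + τ * (n - w.re) + k * (2 * Real.pi) - θ
            = w.im - τ * w.re - (θ - τ * n - k * (2 * Real.pi)) := by ring
        rw [hr]; exact hwa)
      rw [mem_image_iff hL h0 hR, Real.log_exp] at h1
      obtain ⟨ζ, hζ, he⟩ := h1
      have hζ2 : (ζ + (-k : ℤ) * (2 * Real.pi * Complex.I)).re < 0 := by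
        simpa using hζ
      have h2 := lift_leftinv hL.1 hD hζ2 (T := n - w.re) (by linarith)
      rw [lift_shift, he] at h2
      convert h2 using 1
      apply Complex.ext
      · simp
      · simp; ring
  obtain ⟨N, hN⟩ := eventually_atTop.mp hev2
  refine ⟨(hN N le_rfl).1, ?_⟩
  choose σ hσ hs using fun n : ℕ => (hN (N + n) (Nat.le_add_right N n)).2
  obtain ⟨σ₀, -, φ, hφ, hlim⟩ := isCompact_Icc.tendsto_subseq hσ
  refine ⟨σ₀, fun w hw => ?_⟩
  have e1 : ∀ᶠ n in atTop, |w.im - τ * w.re - σ (φ n)| < a / 2 := by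
    have : Tendsto (fun n => |w.im - τ * w.re - σ (φ n)|) atTop (𝓝 |w.im - τ * w.re - σ₀|) :=
      (tendsto_const_nhds.sub hlim).abs
    exact this.eventually (gt_mem_nhds hw)
  have e2 : ∀ᶠ n in atTop, w.re ≤ ((N + φ n : ℕ) : ℝ) := by
    have : Tendsto (fun n => ((N + φ n : ℕ) : ℝ)) atTop atTop :=
      tendsto_natCast_atTop_atTop.comp
        (tendsto_atTop_mono (fun n => Nat.le_add_left _ _) hφ.tendsto_atTop)
    exact this.eventually_ge_atTop _
  obtain ⟨n, h1, h2⟩ := (e1.and e2).exists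
  exact hs (φ n) w h2 h1

lemma spiral_deriv {lam : ℝ} (hc : 0 < Real.cos lam) {f L : ℂ → ℂ} (hf : f ∈ SpiralClass lam)
    (hL : IsLogBranch f L) (ζ : ℂ) (hζ : ζ.re < 0) :
    0 < (liftD L ζ).re + Real.tan lam * (liftD L ζ).im := by
  obtain ⟨hd, h0, h1, hne, hpos⟩ := hf
  have hz := exp_mem_ball hζ
  have hz0 := Complex.exp_ne_zero ζ
  have hp := hpos _ hz hz0
  have hLe := hL.2.2 _ hz hz0
  unfold liftD
  set z := Complex.exp ζ with hzdef
  have hfe : f =ᶠ[𝓝 z] fun w => w * Complex.exp (L w) := by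
    filter_upwards [isOpen_ball.mem_nhds hz, isOpen_ne.mem_nhds hz0] with w hw hw0
    have hw0' : w ≠ 0 := hw0
    rw [hL.2.2 w hw hw0]; field_simp
  have hLd : HasDerivAt L (deriv L z) z :=
    (hL.1.differentiableAt (isOpen_ball.mem_nhds hz)).hasDerivAt
  have hder : deriv f z = 1 * Complex.exp (L z) + z * (Complex.exp (L z) * deriv L z) := by
    rw [hfe.deriv_eq]
    exact ((hasDerivAt_id z).mul hLd.cexp).deriv
  have hfz : f z = z * Complex.exp (L z) := hfe.eq_of_nhds
  have heq : Complex.exp (-(lam : ℂ) * Complex.I) * z * deriv f z / f z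
      = Complex.exp (((-lam : ℝ) : ℂ) * Complex.I) * (1 + z * deriv L z) := by
    have he := Complex.exp_ne_zero (L z)
    rw [hder, hfz]; push_cast; field_simp
  rw [heq, Complex.mul_re, Complex.exp_ofReal_mul_I_re, Complex.exp_ofReal_mul_I_im, Real.cos_neg,
    Real.sin_neg] at hp
  rw [Real.tan_eq_sin_div_cos]
  have : (1 + z * deriv L z).re + Real.sin lam / Real.cos lam * (1 + z * deriv L z).im
    = (Real.cos lam * (1 + z * deriv L z).re - -Real.sin lam * (1 + z * deriv L z).im)
      / Real.cos lam := by field_simp; ring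
  rw [this]
  exact div_pos hp hc

/-- if `f ∈ F_λ` and `g ∈ S*` correspond via `L_f = e^{iλ}(cos λ)·L_g`,
then `A(f) = A(g)`, where `A(h) = lim_{R→∞} α(R, h)`. -/
theorem arc_limit_eq_of_correspondence (lam : ℝ)
    (hlam : lam ∈ Set.Ioo (-(Real.pi / 2)) (Real.pi / 2))
    (f g : ℂ → ℂ) (hf : f ∈ SpiralClass lam) (hg : g ∈ SpiralClass 0)
    (Lf Lg : ℂ → ℂ) (hLf : IsLogBranch f Lf) (hLg : IsLogBranch g Lg)
    (hcorr : ∀ z ∈ ball (0 : ℂ) 1,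
      Lf z = Complex.exp ((lam : ℂ) * Complex.I) * (Real.cos lam : ℂ) * Lg z)
    (Af Ag : ℝ)
    (hAf : Tendsto (arcLength f) atTop (𝓝 Af))
    (hAg : Tendsto (arcLength g) atTop (𝓝 Ag)) :
    Af = Ag := by
  have hc : 0 < Real.cos lam := Real.cos_pos_of_mem_Ioo hlam
  have hDf := spiral_deriv hc hf hLf
  have hDg := spiral_deriv (lam := 0) (by simp) hg hLg
  have hDg' : ∀ ζ : ℂ, ζ.re < 0 → 0 < (liftD Lg ζ).re := by
    intro ζ hζ; simpa using hDg ζ hζ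
  have hf0 : f 0 = 0 := hf.2.1
  have hg0 : g 0 = 0 := hg.2.1
  have hne : ∀ {L : ℂ → ℂ} {τ : ℝ}, (∀ ζ : ℂ, ζ.re < 0 → 0 < (liftD L ζ).re + τ * (liftD L ζ).im) →
      ∀ ζ : ℂ, ζ.re < 0 → liftD L ζ ≠ 0 := by
    intro L τ h ζ hζ h0
    have := h ζ hζ
    rw [h0] at this; simp at this
  have hcl : ∀ {L : ℂ → ℂ}, DifferentiableOn ℂ L (ball (0 : ℂ) 1) →
      ContinuousOn (lift L) {ζ : ℂ | ζ.re < 0} := fun hL ζ hζ =>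
    (hasDerivAt_lift hL hζ).continuousAt.continuousWithinAt
  have him := fun (ζ : ℂ) (hζ : ζ.re < 0) => im_bound hLg.1 hLg.2.1 hDg' hζ
  set c := Real.cos lam with hcdef
  set s := Real.sin lam with hsdef
  have hsc : s ^ 2 + c ^ 2 = 1 := Real.sin_sq_add_cos_sq lam
  have htan : Real.tan lam = s / c := Real.tan_eq_sin_div_cos lam
  have hLre : ∀ ζ : ℂ, ζ.re < 0 → (Lf (Complex.exp ζ)).re
      = c ^ 2 * (Lg (Complex.exp ζ)).re - s * c * (Lg (Complex.exp ζ)).im := by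
    intro ζ hζ
    rw [hcorr _ (exp_mem_ball hζ)]
    simp only [Complex.mul_re, Complex.mul_im, Complex.exp_ofReal_mul_I_re,
      Complex.exp_ofReal_mul_I_im, Complex.ofReal_re, Complex.ofReal_im]
    rw [← hcdef, ← hsdef]; ring
  have hLim : ∀ ζ : ℂ, ζ.re < 0 → (Lf (Complex.exp ζ)).im
      = c ^ 2 * (Lg (Complex.exp ζ)).im + s * c * (Lg (Complex.exp ζ)).re := by
    intro ζ hζ
    rw [hcorr _ (exp_mem_ball hζ)]
    simp only [Complex.mul_re, Complex.mul_im, Complex.exp_ofReal_mul_I_re,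
      Complex.exp_ofReal_mul_I_im, Complex.ofReal_re, Complex.ofReal_im]
    rw [← hcdef, ← hsdef]; ring
  have hcoord : ∀ ζ : ℂ, ζ.re < 0 → ((lift Lf ζ).im - Real.tan lam * (lift Lf ζ).re)
      - ((lift Lg ζ).im - Real.tan 0 * (lift Lg ζ).re) = - Real.tan lam * ζ.re := by
    intro ζ hζ
    simp only [lift, Complex.add_re, Complex.add_im, hLre ζ hζ, hLim ζ hζ, Real.tan_zero, htan]
    field_simp
    linear_combination (Lg (Complex.exp ζ)).im * c * hsc
  have hscim : ∀ ζ : ℂ, ζ.re < 0 → |s * c * (Lg (Complex.exp ζ)).im| ≤ 2 * Real.pi := by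
    intro ζ hζ
    have h1 : |s * c| ≤ 1 := by
      rw [abs_le]; constructor <;> nlinarith [sq_nonneg (s + c), sq_nonneg (s - c)]
    rw [abs_mul]
    have := him ζ hζ
    calc _ ≤ 1 * (2 * Real.pi) := by gcongr
      _ = _ := one_mul _
  have hnear : ∀ {L : ℂ → ℂ}, DifferentiableOn ℂ L (ball (0 : ℂ) 1) → ∀ ε > 0, ∃ T : ℝ,
      ∀ ζ : ℂ, T ≤ (lift L ζ).re → -ε < ζ.re := by
    intro L hL ε hε
    obtain ⟨M, hM⟩ := L_bound hL (x₀ := -ε) (by linarith)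
    refine ⟨M, fun ζ h => ?_⟩
    by_contra hcon
    push Not at hcon
    have h1 := hM ζ hcon
    have h2 := Complex.re_le_norm (L (Complex.exp ζ))
    simp only [lift, Complex.add_re] at h
    linarith
  have hc2 : 0 < c ^ 2 := by positivity
  have hC : ∀ ζ : ℂ, ζ.re < 0 → |((lift Lf ζ).im - Real.tan lam * (lift Lf ζ).re)
      - ((lift Lg ζ).im - Real.tan 0 * (lift Lg ζ).re)| ≤ |Real.tan lam| * |ζ.re| := by
    intro ζ hζ
    rw [hcoord ζ hζ, abs_mul, abs_neg]
  apply le_antisymm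
  · by_contra! hlt
    have h0 : 0 ≤ Ag := strip_le (τ := 0) hLg hg0 hAg le_rfl Real.two_pi_pos.le (σ := 0)
      (fun w hw => absurd hw (by simp))
    obtain ⟨h2π, σ, hσ⟩ := exists_strip hLf hf0 hDf hAf (a := (Ag + Af) / 2)
      (by linarith) (by linarith)
    have hfin := transfer (F₂ := lift Lg) (τ₂ := Real.tan 0) (C := |Real.tan lam|)
      (lift_injOn hLf.1 hDf)
      (fun ζ hζ => ⟨_, hne hDf ζ hζ, hasStrictDerivAt_lift hLf.1 hζ⟩) (hcl hLg.1)
      (fun ζ hζ T hT => lift_leftinv hLg.1 hDg hζ hT)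
      (fun ζ hζ => by rw [abs_sub_comm]; exact hC ζ hζ) (by
        intro ε hε M
        obtain ⟨T₁, hT₁⟩ := hnear hLf.1 ε hε
        refine ⟨max T₁ (c ^ 2 * M + 2 * Real.pi), fun ζ hζ hT => ?_⟩
        refine ⟨hT₁ ζ ((le_max_left _ _).trans hT), ?_⟩
        have h3 := (le_max_right _ _).trans hT
        have h4 := abs_le.mp (hscim ζ hζ)
        simp only [lift, Complex.add_re] at h3 ⊢
        rw [hLre ζ hζ] at h3
        refine le_of_mul_le_mul_left ?_ hc2
        nlinarith [mul_nonneg (sq_nonneg s) (neg_nonneg.mpr hζ.le)]) hσ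
    have := strip_le hLg hg0 hAg (by linarith) h2π hfin
    linarith
  · by_contra! hlt
    have h0 : 0 ≤ Af := strip_le (τ := 0) hLf hf0 hAf le_rfl Real.two_pi_pos.le (σ := 0)
      (fun w hw => absurd hw (by simp))
    obtain ⟨h2π, σ, hσ⟩ := exists_strip hLg hg0 hDg hAg (a := (Ag + Af) / 2)
      (by linarith) (by linarith)
    have hfin := transfer (F₂ := lift Lf) (τ₂ := Real.tan lam) (C := |Real.tan lam|)
      (lift_injOn hLg.1 hDg)
      (fun ζ hζ => ⟨_, hne hDg ζ hζ, hasStrictDerivAt_lift hLg.1 hζ⟩) (hcl hLf.1)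
      (fun ζ hζ T hT => lift_leftinv hLf.1 hDf hζ hT) hC (by
        intro ε hε M
        obtain ⟨T₁, hT₁⟩ := hnear hLg.1 ε hε
        obtain ⟨T₂, hT₂⟩ := hnear hLg.1 1 one_pos
        refine ⟨max T₁ (max T₂ ((M + 1 + 2 * Real.pi) / c ^ 2)), fun ζ hζ hT => ?_⟩
        refine ⟨hT₁ ζ ((le_max_left _ _).trans hT), ?_⟩
        have h2 := hT₂ ζ (((le_max_left _ _).trans (le_max_right _ _)).trans hT)
        have h3 := ((le_max_right _ _).trans (le_max_right _ _)).trans hT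
        have h4 := abs_le.mp (hscim ζ hζ)
        rw [div_le_iff₀ hc2] at h3
        simp only [lift, Complex.add_re] at h3 ⊢
        rw [hLre ζ hζ]
        have h5 : s ^ 2 ≤ 1 := by nlinarith
        nlinarith [mul_nonneg (sq_nonneg s) (by linarith : 0 ≤ ζ.re + 1)]) hσ
    have := strip_le hLf hf0 hAf (by linarith) h2π hfin
    linarith
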